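/- For every nonnegative integer n and every k with 0 ≤ k ≤ 10, the number of partitions of 11n+6 whose crank is congruent to k modulo 11 equals p(11n+6)/11; that is, M(k,11,11n+6) = p(11n+6)/11. -/

import Mathlib

/-- The *crank* of a partition `π`: if `μ(π)` (the number of ones in `π`) is zero, it is
`λ(π)`, the largest part of `π`; otherwise it is `ν(π) - μ(π)`, where `ν(π)` is the number
of parts of `π` larger than `μ(π)`. -/
def partitionCrank {n : ℕ} (p : Nat.Partition n) : ℤ :=
  if p.parts.count 1 = 0 then (p.parts.sup : ℤ)
  else (Multiset.card (p.parts.filter (fun x => p.parts.count 1 < x)) : ℤ)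
    - (p.parts.count 1 : ℤ)

section

open PowerSeries Filter Topology
open scoped PowerSeries.WithPiTopology

section Convergence

variable {K : Type*} [CommRing K] [TopologicalSpace K]

theorem tendsto_of_X_pow_dvd_sub {f : ℕ → K⟦X⟧} {g : K⟦X⟧}
    (h : ∀ n, (X : K⟦X⟧) ^ n ∣ f n - g) : Tendsto f atTop (𝓝 g) := by
  rw [WithPiTopology.tendsto_iff_coeff_tendsto]
  refine fun d ↦ tendsto_atTop_of_eventually_const (i₀ := d + 1) fun n hn ↦ ?_
  rw [← sub_eq_zero, ← map_sub]
  exact X_pow_dvd_iff.1 (h n) d hn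

theorem hasSum_coeff_of_X_pow_dvd {f : ℕ → K⟦X⟧} (h : ∀ j, (X : K⟦X⟧) ^ j ∣ f j) (d : ℕ) :
    HasSum (fun j ↦ coeff d (f j)) (∑ j ∈ Finset.range (d + 1), coeff d (f j)) :=
  hasSum_sum_of_ne_finset_zero fun j hj ↦ X_pow_dvd_iff.1 (h j) d (by simpa using hj)

theorem summable_of_X_pow_dvd {f : ℕ → K⟦X⟧} (h : ∀ j, (X : K⟦X⟧) ^ j ∣ f j) : Summable f :=
  (WithPiTopology.summable_iff_summable_coeff K).2 fun d ↦
    (hasSum_coeff_of_X_pow_dvd h d).summable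

theorem coeff_tsum_of_X_pow_dvd [T2Space K] {f : ℕ → K⟦X⟧} (h : ∀ j, (X : K⟦X⟧) ^ j ∣ f j)
    (d : ℕ) : coeff d (∑' j, f j) = ∑ j ∈ Finset.range (d + 1), coeff d (f j) :=
  ((WithPiTopology.hasSum_iff_hasSum_coeff K).1 (summable_of_X_pow_dvd h).hasSum d).unique
    (hasSum_coeff_of_X_pow_dvd h d)

theorem X_pow_dvd_tsum [T2Space K] {f : ℕ → K⟦X⟧} (h : ∀ j, (X : K⟦X⟧) ^ j ∣ f j) {r : ℕ}
    (hr : ∀ j, (X : K⟦X⟧) ^ r ∣ f j) : (X : K⟦X⟧) ^ r ∣ ∑' j, f j := by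
  rw [X_pow_dvd_iff]
  intro m hm
  rw [coeff_tsum_of_X_pow_dvd h]
  exact Finset.sum_eq_zero fun j _ ↦ X_pow_dvd_iff.1 (hr j) m hm

theorem HasSum.of_eq {ι M : Type*} [AddCommMonoid M] [TopologicalSpace M] {f g : ι → M} {a b : M}
    (h : HasSum f a) (hf : ∀ i, g i = f i) (hb : b = a) : HasSum g b := by
  rwa [hb, funext hf]

theorem summable_C_mul_X_pow {ι : Type*} (c : ι → K) {e : ι → ℕ}
    (he : ∀ N, {i | e i ≤ N}.Finite) : Summable fun i ↦ C (c i) * (X : K⟦X⟧) ^ e i := by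
  rw [WithPiTopology.summable_iff_summable_coeff]
  intro d
  refine summable_of_hasFiniteSupport ((he d).subset fun i hi ↦ ?_)
  by_contra h
  simp only [Set.mem_ofPred_eq, not_le] at h
  simp [coeff_X_pow, h.ne] at hi

end Convergence

section EulerProduct

variable {K : Type*} [CommRing K]

/-- The finite product `(z q; q)_n`. -/
noncomputable def qPoch (z : K) (n : ℕ) : K⟦X⟧ :=
  ∏ i ∈ Finset.range n, (1 - C z * X ^ (i + 1))

/-- The infinite product `(z q; q)_∞`. -/
noncomputable def qPochInf (z : K) : K⟦X⟧ := mk fun n ↦ coeff n (qPoch z n)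

theorem qPoch_succ (z : K) (n : ℕ) : qPoch z (n + 1) = qPoch z n * (1 - C z * X ^ (n + 1)) :=
  Finset.prod_range_succ _ _

@[simp] theorem qPoch_zero (z : K) : qPoch z 0 = 1 := Finset.prod_range_zero _

@[simp] theorem constantCoeff_qPoch (z : K) (n : ℕ) : constantCoeff (qPoch z n) = 1 := by
  simp [qPoch, map_prod]

@[simp] theorem constantCoeff_qPochInf (z : K) : constantCoeff (qPochInf z) = 1 := by
  rw [← coeff_zero_eq_constantCoeff_apply, qPochInf, coeff_mk, coeff_zero_eq_constantCoeff_apply,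
    constantCoeff_qPoch]

theorem X_pow_dvd_qPoch_sub_qPoch (z : K) {m n : ℕ} (h : m ≤ n) :
    X ^ (m + 1) ∣ qPoch z n - qPoch z m := by
  induction n, h using Nat.le_induction with
  | base => simp
  | succ n hn ih =>
    have : qPoch z (n + 1) - qPoch z m =
        (qPoch z n - qPoch z m) - qPoch z n * C z * X ^ (n + 1) := by rw [qPoch_succ]; ring
    rw [this]
    exact dvd_sub ih (Dvd.dvd.mul_left (pow_dvd_pow _ (by omega)) _)

theorem X_pow_dvd_qPoch_sub_qPochInf (z : K) (n : ℕ) :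
    X ^ (n + 1) ∣ qPoch z n - qPochInf z := by
  rw [X_pow_dvd_iff]
  intro m hm
  have := X_pow_dvd_iff.1 (X_pow_dvd_qPoch_sub_qPoch z (Nat.le_of_lt_succ hm)) m (by omega)
  simpa [qPochInf] using this

theorem tendsto_qPoch [TopologicalSpace K] (z : K) :
    Tendsto (qPoch z) atTop (𝓝 (qPochInf z)) :=
  tendsto_of_X_pow_dvd_sub fun n ↦
    (pow_dvd_pow _ n.le_succ).trans (X_pow_dvd_qPoch_sub_qPochInf z n)

theorem qPochInf_one_eq_pentagonalSeries : qPochInf (1 : K) = pentagonalSeries K := by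
  let : TopologicalSpace K := ⊥
  have : DiscreteTopology K := ⟨rfl⟩
  refine tendsto_nhds_unique (tendsto_qPoch 1) ?_
  have h : (qPoch (1 : K)) = fun n ↦ ∏ i ∈ Finset.range n, (1 - X ^ (i + 1)) := by
    simp [funext_iff, qPoch]
  exact h ▸ (WithPiTopology.hasProd_one_sub_X_pow K).tendsto_prod_nat

@[simp] theorem qPochInf_zero : qPochInf (0 : K) = 1 := by
  ext n
  simp [qPochInf, qPoch]

end EulerProduct

section Inverse

variable {K : Type*} [Field K]

theorem qPoch_ne_zero (z : K) (n : ℕ) : qPoch z n ≠ 0 := fun h ↦ by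
  simpa [h] using constantCoeff_qPoch z n

theorem qPochInf_ne_zero (z : K) : qPochInf z ≠ 0 := fun h ↦ by
  simpa [h] using constantCoeff_qPochInf z

theorem qPoch_mul_inv (z : K) (n : ℕ) : qPoch z n * (qPoch z n)⁻¹ = 1 :=
  PowerSeries.mul_inv_cancel _ (by simp)

theorem qPochInf_mul_inv (z : K) : qPochInf z * (qPochInf z)⁻¹ = 1 :=
  PowerSeries.mul_inv_cancel _ (by simp)

theorem inv_qPoch_eq (z : K) (n : ℕ) :
    (qPoch z n)⁻¹ = (1 - C z * X ^ (n + 1)) * (qPoch z (n + 1))⁻¹ := by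
  apply mul_left_cancel₀ (qPoch_ne_zero z n)
  rw [qPoch_mul_inv, ← mul_assoc, ← qPoch_succ, qPoch_mul_inv]

theorem tendsto_inv_qPoch [TopologicalSpace K] (z : K) :
    Tendsto (fun n ↦ (qPoch z n)⁻¹) atTop (𝓝 (qPochInf z)⁻¹) := by
  refine tendsto_of_X_pow_dvd_sub fun n ↦ ?_
  have : (qPoch z n)⁻¹ - (qPochInf z)⁻¹ =
      -(qPoch z n - qPochInf z) * ((qPoch z n)⁻¹ * (qPochInf z)⁻¹) := by
    linear_combination (qPochInf z)⁻¹ * qPoch_mul_inv z n - (qPoch z n)⁻¹ * qPochInf_mul_inv z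
  rw [this]
  exact Dvd.dvd.mul_right ((dvd_neg).2
    ((pow_dvd_pow _ n.le_succ).trans (X_pow_dvd_qPoch_sub_qPochInf z n))) _

end Inverse

section QBinomial

variable {K : Type*} [Field K] [TopologicalSpace K] [IsTopologicalRing K] [T2Space K]

/-- The summand of the basic hypergeometric series `∑ (z q; q)_j / (q; q)_j (y q ^ r) ^ j`. -/
noncomputable def qBinomTerm (z y : K) (r j : ℕ) : K⟦X⟧ :=
  qPoch z j * (qPoch 1 j)⁻¹ * C (y ^ j) * X ^ (r * j)

omit [TopologicalSpace K] [IsTopologicalRing K] [T2Space K] in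
theorem X_pow_dvd_qBinomTerm (z y : K) (r j : ℕ) : X ^ j ∣ qBinomTerm z y (r + 1) j :=
  Dvd.dvd.mul_left (pow_dvd_pow _ (by nlinarith)) _

theorem tsum_qBinomTerm_mul (z y : K) (r : ℕ) :
    (∑' j, qBinomTerm z y (r + 1) j) * (1 - C y * X ^ (r + 1)) =
      (1 - C (z * y) * X ^ (r + 2)) * ∑' j, qBinomTerm z y (r + 2) j := by
  have h1 := summable_of_X_pow_dvd (X_pow_dvd_qBinomTerm z y r)
  have h2 := summable_of_X_pow_dvd (X_pow_dvd_qBinomTerm z y (r + 1))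
  have key : ∀ j, qBinomTerm z y (r + 1) (j + 1) - qBinomTerm z y (r + 2) (j + 1) =
      C y * X ^ (r + 1) * qBinomTerm z y (r + 1) j -
        C (z * y) * X ^ (r + 2) * qBinomTerm z y (r + 2) j := by
    intro j
    simp only [qBinomTerm, inv_qPoch_eq (1 : K) j, qPoch_succ z j, map_mul, map_pow, map_one]
    ring
  have h3 := ((summable_nat_add_iff 1).2 h1).tsum_sub ((summable_nat_add_iff 1).2 h2)
  simp_rw [key] at h3
  rw [(h1.mul_left _).tsum_sub (h2.mul_left _), h1.tsum_mul_left, h2.tsum_mul_left] at h3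
  rw [h1.tsum_eq_zero_add, h2.tsum_eq_zero_add] at h3 ⊢
  have h0 : ∀ r, qBinomTerm z y r 0 = 1 := by simp [qBinomTerm]
  rw [h0, h0] at h3 ⊢
  linear_combination -h3

/-- The `q`-binomial theorem. -/
theorem tsum_qBinomTerm_mul_qPochInf (z y : K) :
    (∑' j, qBinomTerm z y 1 j) * (1 - C (z * y) * X) * qPochInf y = qPochInf (z * y) := by
  have fin : ∀ n, (∑' j, qBinomTerm z y 1 j) * (1 - C (z * y) * X) * qPoch y n =
      qPoch (z * y) (n + 1) * ∑' j, qBinomTerm z y (n + 1) j := by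
    intro n
    induction n with
    | zero => simp [qPoch_succ, mul_comm]
    | succ n ih =>
      rw [qPoch_succ y, ← mul_assoc, ih, mul_assoc, tsum_qBinomTerm_mul, qPoch_succ _ (n + 1),
        mul_assoc]
  have lim : Tendsto (fun n ↦ ∑' j, qBinomTerm z y (n + 1) j) atTop (𝓝 1) := by
    refine tendsto_of_X_pow_dvd_sub fun n ↦ ?_
    have h := X_pow_dvd_qBinomTerm z y n
    rw [(summable_of_X_pow_dvd h).tsum_eq_zero_add]
    have h0 : qBinomTerm z y (n + 1) 0 = 1 := by simp [qBinomTerm]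
    rw [h0, add_sub_cancel_left]
    exact X_pow_dvd_tsum (fun j ↦ (pow_dvd_pow _ j.le_succ).trans (h (j + 1)))
      fun j ↦ Dvd.dvd.mul_left (pow_dvd_pow _ (by nlinarith)) _
  refine tendsto_nhds_unique ((tendsto_qPoch y).const_mul _) ?_
  simp_rw [fin]
  simpa using ((tendsto_add_atTop_iff_nat 1).2 (tendsto_qPoch (z * y))).mul lim

end QBinomial

section JacobiTripleProduct

/-- The triangular number `j (j - 1) / 2` of an integer. -/
def triangular (j : ℤ) : ℕ := (j * (j - 1) / 2).toNat

theorem two_mul_triangular (j : ℤ) : 2 * (triangular j : ℤ) = j * (j - 1) := by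
  have h0 : 0 ≤ j * (j - 1) := by
    rcases le_or_gt j 0 with h | h <;> nlinarith
  have h2 : 2 ∣ j * (j - 1) := by
    simpa [mul_comm] using (Int.even_mul_pred_self j).two_dvd
  rw [triangular, Int.toNat_of_nonneg (by omega)]
  omega

theorem finite_triangular_le (N : ℕ) : {j : ℤ | triangular j ≤ N}.Finite := by
  refine (Set.finite_Icc (-(2 * N + 1) : ℤ) (2 * N + 1)).subset fun j hj ↦ ?_
  have h := two_mul_triangular j
  have hj' : (triangular j : ℤ) ≤ N := by exact_mod_cast hj
  constructor <;> nlinarith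

variable {K : Type*} [Field K]

/-- The reciprocal `1 / (q; q)_k`, which is zero for negative `k`. -/
noncomputable def invQPoch (K : Type*) [Field K] (k : ℤ) : K⟦X⟧ :=
  if k < 0 then 0 else (qPoch 1 k.toNat)⁻¹

theorem invQPoch_of_neg {k : ℤ} (h : k < 0) : invQPoch K k = 0 := if_pos h

theorem invQPoch_natCast (k : ℕ) : invQPoch K k = (qPoch 1 k)⁻¹ := by simp [invQPoch]

theorem invQPoch_natCast_sub_one (k : ℕ) :
    invQPoch K (k - 1) = (1 - X ^ k) * invQPoch K k := by
  cases k with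
  | zero => simp [invQPoch_of_neg]
  | succ k =>
    rw [Nat.cast_succ, add_sub_cancel_right, ← Nat.cast_succ, invQPoch_natCast, invQPoch_natCast,
      inv_qPoch_eq]
    simp

theorem X_pow_mul_invQPoch_sub_two {a b c : ℕ} (h : a + b = c + 1) :
    X ^ a * invQPoch K (b - 2) = (X ^ a - X ^ c) * (1 - X ^ b) * invQPoch K b := by
  cases b with
  | zero => simp [invQPoch_of_neg]
  | succ b =>
    have hc : c = a + b := by omega
    have h1 := invQPoch_natCast_sub_one (K := K) (b + 1)
    have h2 := invQPoch_natCast_sub_one (K := K) b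
    push_cast at h1 ⊢
    rw [add_sub_cancel_right] at h1
    rw [show (b : ℤ) + 1 - 2 = b - 1 by ring, h2, h1, hc, pow_add]
    ring

/-- The coefficients of the finite form of the Jacobi triple product. -/
noncomputable def jacobiCoeff (K : Type*) [Field K] (n : ℕ) (j : ℤ) : K⟦X⟧ :=
  qPoch 1 (2 * n) * (invQPoch K (n - j) * invQPoch K (n + j))

theorem jacobiCoeff_succ {n a b : ℕ} (h : a + b = 2 * n + 2) :
    qPoch 1 (2 * n + 2) * (invQPoch K a * invQPoch K b) =
      qPoch 1 (2 * n) * ((1 + X ^ (2 * n + 1)) * (invQPoch K (a - 1) * invQPoch K (b - 1)) +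
        X ^ a * (invQPoch K a * invQPoch K (b - 2)) +
        X ^ b * (invQPoch K (a - 2) * invQPoch K b)) := by
  have h1 := X_pow_mul_invQPoch_sub_two (K := K) (a := a) (b := b) (c := 2 * n + 1) (by omega)
  have h2 := X_pow_mul_invQPoch_sub_two (K := K) (a := b) (b := a) (c := 2 * n + 1) (by omega)
  have h3 : (X : K⟦X⟧) ^ a * X ^ b = X ^ (2 * n + 1) * X := by rw [← pow_add, h, pow_succ]
  rw [invQPoch_natCast_sub_one, invQPoch_natCast_sub_one, show 2 * n + 2 = 2 * n + 1 + 1 from rfl,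
    qPoch_succ, qPoch_succ]
  simp only [map_one, one_mul]
  rw [pow_succ X (2 * n + 1)]
  linear_combination -qPoch 1 (2 * n) * invQPoch K a * h1 - qPoch 1 (2 * n) * invQPoch K b * h2 -
    qPoch 1 (2 * n) * invQPoch K a * invQPoch K b * (X ^ (2 * n + 1) - 1) * h3

/-- The summand of the finite form of the Jacobi triple product. -/
noncomputable def jacobiTerm (x : K) (n : ℕ) (j : ℤ) : K⟦X⟧ :=
  C ((-x) ^ j) * X ^ triangular j * jacobiCoeff K n j

theorem jacobiTerm_succ {x : K} (hx : x ≠ 0) (n : ℕ) (j : ℤ) :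
    jacobiTerm x (n + 1) j = (1 + X ^ (2 * n + 1)) * jacobiTerm x n j -
      C x * X ^ n * jacobiTerm x n (j - 1) - C x⁻¹ * X ^ (n + 1) * jacobiTerm x n (j + 1) := by
  have hx' : -x ≠ 0 := neg_ne_zero.2 hx
  unfold jacobiTerm jacobiCoeff
  rcases lt_or_ge j (-(n + 1)) with h | h
  · simp only [Nat.cast_succ]
    rw [invQPoch_of_neg (k := (n : ℤ) + 1 + j) (by omega),
      invQPoch_of_neg (k := (n : ℤ) + j) (by omega),
      invQPoch_of_neg (k := (n : ℤ) + (j - 1)) (by omega),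
      invQPoch_of_neg (k := (n : ℤ) + (j + 1)) (by omega)]
    simp
  rcases lt_or_ge (n + 1 : ℤ) j with h' | h'
  · simp only [Nat.cast_succ]
    rw [invQPoch_of_neg (k := (n : ℤ) + 1 - j) (by omega),
      invQPoch_of_neg (k := (n : ℤ) - j) (by omega),
      invQPoch_of_neg (k := (n : ℤ) - (j - 1)) (by omega),
      invQPoch_of_neg (k := (n : ℤ) - (j + 1)) (by omega)]
    simp
  obtain ⟨a, ha⟩ := Int.eq_ofNat_of_zero_le (a := n + 1 - j) (by omega)
  obtain ⟨b, hb⟩ := Int.eq_ofNat_of_zero_le (a := n + 1 + j) (by omega)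
  have key := jacobiCoeff_succ (K := K) (n := n) (a := a) (b := b) (by omega)
  have e1 := two_mul_triangular j
  have e2 := two_mul_triangular (j - 1)
  have e3 := two_mul_triangular (j + 1)
  have p1 : (X : K⟦X⟧) ^ triangular j * X ^ a = X ^ n * X ^ triangular (j - 1) := by
    rw [← pow_add, ← pow_add]
    congr 1
    have : 2 * ((triangular j : ℤ) + a) = 2 * (n + triangular (j - 1)) := by
      linear_combination e1 - e2 - 2 * ha
    omega
  have p2 : (X : K⟦X⟧) ^ triangular j * X ^ b = X ^ (n + 1) * X ^ triangular (j + 1) := by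
    rw [← pow_add, ← pow_add]
    congr 1
    have : 2 * ((triangular j : ℤ) + b) = 2 * (n + 1 + triangular (j + 1)) := by
      linear_combination e1 - e3 - 2 * hb
    omega
  have q1 : (C (-x) ^ 1 : K⟦X⟧) * C ((-x) ^ (j - 1)) = C ((-x) ^ j) := by
    rw [pow_one, ← map_mul, mul_comm, zpow_sub_one₀ hx', inv_mul_cancel_right₀ hx']
  have q2 : (C (-x⁻¹) ^ 1 : K⟦X⟧) * C ((-x) ^ (j + 1)) = C ((-x) ^ j) := by
    rw [pow_one, ← map_mul, mul_comm, zpow_add_one₀ hx', ← inv_neg, mul_inv_cancel_right₀ hx']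
  rw [show ((n + 1 : ℕ) : ℤ) - j = a by push_cast; omega,
    show ((n + 1 : ℕ) : ℤ) + j = b by push_cast; omega, show (n : ℤ) - j = a - 1 by omega,
    show (n : ℤ) + j = b - 1 by omega, show (n : ℤ) - (j - 1) = a by omega,
    show (n : ℤ) + (j - 1) = b - 2 by omega, show (n : ℤ) - (j + 1) = a - 2 by omega,
    show (n : ℤ) + (j + 1) = b by omega, show 2 * (n + 1) = 2 * n + 2 by ring, key]
  simp only [map_neg, pow_one] at q1 q2
  linear_combination C ((-x) ^ j) * qPoch 1 (2 * n) * invQPoch K a * invQPoch K (b - 2) * p1 +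
    C ((-x) ^ j) * qPoch 1 (2 * n) * invQPoch K (a - 2) * invQPoch K b * p2 -
    X ^ n * X ^ triangular (j - 1) * qPoch 1 (2 * n) * invQPoch K a * invQPoch K (b - 2) * q1 -
    X ^ (n + 1) * X ^ triangular (j + 1) * qPoch 1 (2 * n) * invQPoch K (a - 2) *
      invQPoch K b * q2

theorem prod_one_sub_eq_qPoch (x : K) (n : ℕ) :
    ∏ i ∈ Finset.range (n + 1), (1 - C x * X ^ i : K⟦X⟧) = (1 - C x) * qPoch x n := by
  rw [Finset.prod_range_succ']
  simp [qPoch, mul_comm]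

variable [TopologicalSpace K] [IsTopologicalRing K]

/-- The finite form of the Jacobi triple product. -/
theorem hasSum_jacobiTerm {x : K} (hx : x ≠ 0) (n : ℕ) :
    HasSum (jacobiTerm x n)
      ((∏ i ∈ Finset.range n, (1 - C x * X ^ i)) * qPoch x⁻¹ n) := by
  induction n with
  | zero =>
    convert hasSum_single (f := jacobiTerm x 0) 0 fun j hj ↦ ?_
    · simp [jacobiTerm, jacobiCoeff, triangular, invQPoch]
    · rcases lt_or_gt_of_ne hj with h | h
      · simp [jacobiTerm, jacobiCoeff, invQPoch_of_neg h]
      · simp [jacobiTerm, jacobiCoeff, invQPoch_of_neg (k := -j) (by omega)]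
  | succ n ih =>
    have h1 := (Equiv.subRight (1 : ℤ)).hasSum_iff.2 ih
    have h2 := (Equiv.addRight (1 : ℤ)).hasSum_iff.2 ih
    refine (((ih.mul_left (1 + X ^ (2 * n + 1))).sub (h1.mul_left (C x * X ^ n))).sub
      (h2.mul_left (C x⁻¹ * X ^ (n + 1)))).of_eq (jacobiTerm_succ hx n) ?_
    · rw [Finset.prod_range_succ, qPoch_succ]
      have : (C x * C x⁻¹ : K⟦X⟧) = 1 := by rw [← map_mul, mul_inv_cancel₀ hx, map_one]
      linear_combination (∏ i ∈ Finset.range n, (1 - C x * X ^ i)) * qPoch x⁻¹ n *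
        X ^ (2 * n + 1) * this

theorem tendsto_jacobiCoeff (j : ℤ) :
    Tendsto (fun n ↦ jacobiCoeff K n j) atTop (𝓝 (qPochInf 1)⁻¹) := by
  have h (e : ℕ → ℤ) (he : Tendsto (fun n ↦ (e n).toNat) atTop atTop)
      (hp : ∀ᶠ n in atTop, 0 ≤ e n) :
      Tendsto (fun n ↦ invQPoch K (e n)) atTop (𝓝 (qPochInf 1)⁻¹) := by
    refine ((tendsto_inv_qPoch (1 : K)).comp he).congr' (hp.mono fun n hn ↦ ?_)
    rw [Function.comp_apply, ← invQPoch_natCast, Int.toNat_of_nonneg hn]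
  have ht (k : ℤ) : Tendsto (fun n : ℕ ↦ (n + k).toNat) atTop atTop :=
    tendsto_atTop.2 fun b ↦ eventually_atTop.2 ⟨b + (-k).toNat, fun n hn ↦ by omega⟩
  have hp (k : ℤ) : ∀ᶠ n : ℕ in atTop, 0 ≤ (n + k) :=
    eventually_atTop.2 ⟨(-k).toNat, fun n hn ↦ by omega⟩
  have h2 : Tendsto (fun n ↦ qPoch (1 : K) (2 * n)) atTop (𝓝 (qPochInf 1)) :=
    (tendsto_qPoch 1).comp (tendsto_id.const_mul_atTop' (by norm_num))
  have := h2.mul ((h _ (ht (-j)) (hp (-j))).mul (h _ (ht j) (hp j)))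
  rw [← mul_assoc, qPochInf_mul_inv, one_mul] at this
  exact this

variable [T2Space K]

/-- The Jacobi theta series `∑ (-x) ^ j q ^ (j (j - 1) / 2)` in product form. -/
noncomputable def thetaProd (x : K) : K⟦X⟧ :=
  qPochInf 1 * ((1 - C x) * qPochInf x * qPochInf x⁻¹)

/-- The **Jacobi triple product** identity for formal power series. -/
theorem hasSum_thetaProd {x : K} (hx : x ≠ 0) :
    HasSum (fun j : ℤ ↦ C ((-x) ^ j) * X ^ triangular j) (thetaProd x) := by
  have lim : Tendsto (fun n ↦ (∏ i ∈ Finset.range n, (1 - C x * X ^ i)) * qPoch x⁻¹ n) atTop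
      (𝓝 ((1 - C x) * qPochInf x * qPochInf x⁻¹)) := by
    refine Tendsto.mul ((tendsto_add_atTop_iff_nat 1).1 ?_) (tendsto_qPoch _)
    simp_rw [prod_one_sub_eq_qPoch]
    exact (tendsto_qPoch x).const_mul _
  have main : HasSum (fun j : ℤ ↦ C ((-x) ^ j) * X ^ triangular j * (qPochInf 1)⁻¹)
      ((1 - C x) * qPochInf x * qPochInf x⁻¹) := by
    rw [WithPiTopology.hasSum_iff_hasSum_coeff]
    intro d
    have van (f : ℤ → K⟦X⟧) (j : ℤ) (hj : j ∉ (finite_triangular_le d).toFinset) :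
        coeff d (C ((-x) ^ j) * X ^ triangular j * f j) = 0 := by
      have hj' : d < triangular j := by simpa using hj
      exact X_pow_dvd_iff.1 (Dvd.dvd.mul_right (Dvd.intro_left _ rfl) _) d hj'
    have h1 (n : ℕ) := ((WithPiTopology.hasSum_iff_hasSum_coeff K).1
      (hasSum_jacobiTerm hx n) d).unique (hasSum_sum_of_ne_finset_zero (van (jacobiCoeff K n)))
    have h2 := (WithPiTopology.tendsto_iff_coeff_tendsto K _ _ _).1 lim d
    simp_rw [h1] at h2
    have h3 := tendsto_finsetSum (finite_triangular_le d).toFinset fun j _ ↦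
      (WithPiTopology.tendsto_iff_coeff_tendsto K _ _ _).1
        ((tendsto_jacobiCoeff (K := K) j).const_mul (C ((-x) ^ j) * X ^ triangular j)) d
    rw [tendsto_nhds_unique h2 h3]
    exact hasSum_sum_of_ne_finset_zero (van fun _ ↦ (qPochInf 1)⁻¹)
  refine (main.mul_left (qPochInf 1)).of_eq (fun j ↦ ?_) rfl
  linear_combination -(C ((-x) ^ j) * X ^ triangular j) * qPochInf_mul_inv (1 : K)

end JacobiTripleProduct

section Winquist

theorem finite_pentagonal_le (N : ℕ) : {j : ℤ | pentagonal j ≤ N}.Finite := by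
  refine (Set.finite_Icc (-(2 * N + 1) : ℤ) (2 * N + 1)).subset fun j hj ↦ ?_
  have h := two_mul_natCast_pentagonal j
  have hj' : (pentagonal j : ℤ) ≤ N := by exact_mod_cast hj
  constructor <;> nlinarith

theorem finite_add_le {ι κ : Type*} {e : ι → ℕ} {e' : κ → ℕ} (h : ∀ N, {i | e i ≤ N}.Finite)
    (h' : ∀ N, {i | e' i ≤ N}.Finite) (N : ℕ) : {v : ι × κ | e v.1 + e' v.2 ≤ N}.Finite :=
  ((h N).prod (h' N)).subset fun _ hv ↦
    ⟨(Nat.le_add_right _ _).trans hv, (Nat.le_add_left _ _).trans hv⟩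

variable {K : Type*} [Field K] [TopologicalSpace K] [IsTopologicalRing K] [T2Space K]

theorem hasSum_C_mul_X_pow_mul {ι κ : Type*} {c : ι → K} {c' : κ → K} {e : ι → ℕ} {e' : κ → ℕ}
    (h : ∀ N, {i | e i ≤ N}.Finite) (h' : ∀ N, {i | e' i ≤ N}.Finite) {s s' : K⟦X⟧}
    (hs : HasSum (fun i ↦ C (c i) * X ^ e i) s) (hs' : HasSum (fun i ↦ C (c' i) * X ^ e' i) s') :
    HasSum (fun v : ι × κ ↦ C (c v.1 * c' v.2) * X ^ (e v.1 + e' v.2)) (s * s') := by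
  have key (v : ι × κ) : (C (c v.1 * c' v.2) * X ^ (e v.1 + e' v.2) : K⟦X⟧) =
      C (c v.1) * X ^ e v.1 * (C (c' v.2) * X ^ e' v.2) := by
    rw [map_mul, pow_add]; ring
  refine (hs.mul hs' ?_).of_eq key rfl
  exact (summable_C_mul_X_pow (fun v : ι × κ ↦ c v.1 * c' v.2) (finite_add_le h h')).congr
    key

theorem hasSum_C_mul_X_pow_mul_four {c₁ c₂ c₃ c₄ : ℤ → K} {e₁ e₂ e₃ e₄ : ℤ → ℕ}
    (h₁ : ∀ N, {i | e₁ i ≤ N}.Finite) (h₂ : ∀ N, {i | e₂ i ≤ N}.Finite)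
    (h₃ : ∀ N, {i | e₃ i ≤ N}.Finite) (h₄ : ∀ N, {i | e₄ i ≤ N}.Finite) {s₁ s₂ s₃ s₄ : K⟦X⟧}
    (hs₁ : HasSum (fun i ↦ C (c₁ i) * X ^ e₁ i) s₁)
    (hs₂ : HasSum (fun i ↦ C (c₂ i) * X ^ e₂ i) s₂)
    (hs₃ : HasSum (fun i ↦ C (c₃ i) * X ^ e₃ i) s₃)
    (hs₄ : HasSum (fun i ↦ C (c₄ i) * X ^ e₄ i) s₄) :
    HasSum (fun v : ℤ × ℤ × ℤ × ℤ ↦ C (c₁ v.1 * (c₂ v.2.1 * (c₃ v.2.2.1 * c₄ v.2.2.2))) *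
      X ^ (e₁ v.1 + (e₂ v.2.1 + (e₃ v.2.2.1 + e₄ v.2.2.2)))) (s₁ * (s₂ * (s₃ * s₄))) := by
  have h34 := finite_add_le h₃ h₄
  have hs34 := hasSum_C_mul_X_pow_mul h₃ h₄ hs₃ hs₄
  have h234 := finite_add_le h₂ h34
  have hs234 := hasSum_C_mul_X_pow_mul (c' := fun v : ℤ × ℤ ↦ c₃ v.1 * c₄ v.2)
    (e' := fun v ↦ e₃ v.1 + e₄ v.2) h₂ h34 hs₂ hs34
  exact hasSum_C_mul_X_pow_mul (c' := fun v : ℤ × ℤ × ℤ ↦ c₂ v.1 * (c₃ v.2.1 * c₄ v.2.2))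
    (e' := fun v ↦ e₂ v.1 + (e₃ v.2.1 + e₄ v.2.2)) h₁ h234 hs₁ hs234

/-- The exponent of `q` in the product of four theta series. -/
def winquistExp (v : ℤ × ℤ × ℤ × ℤ) : ℕ :=
  triangular v.1 + (triangular v.2.1 + (triangular v.2.2.1 + triangular v.2.2.2))

/-- The coefficient in the product of the theta series at `a`, `b`, `a b` and `a / b`. -/
def winquistCoeff (a b : K) (v : ℤ × ℤ × ℤ × ℤ) : K :=
  (-1) ^ (v.1 + v.2.1 + v.2.2.1 + v.2.2.2) *
    (a ^ (v.1 + v.2.2.1 + v.2.2.2) * b ^ (v.2.1 + v.2.2.1 - v.2.2.2))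

theorem finite_winquistExp_le (N : ℕ) : {v | winquistExp v ≤ N}.Finite :=
  finite_add_le finite_triangular_le (finite_add_le finite_triangular_le
    (finite_add_le finite_triangular_le finite_triangular_le)) N

theorem hasSum_thetaProd_mul {a b : K} (ha : a ≠ 0) (hb : b ≠ 0) :
    HasSum (fun v ↦ C (winquistCoeff a b v) * X ^ winquistExp v)
      (thetaProd a * (thetaProd b * (thetaProd (a * b) * thetaProd (a / b)))) := by
  refine (hasSum_C_mul_X_pow_mul_four finite_triangular_le finite_triangular_le
    finite_triangular_le finite_triangular_le (hasSum_thetaProd ha) (hasSum_thetaProd hb)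
    (hasSum_thetaProd (mul_ne_zero ha hb)) (hasSum_thetaProd (div_ne_zero ha hb))).of_eq ?_ rfl
  rintro ⟨i, j, k, l⟩
  simp only [winquistCoeff, winquistExp]
  congr 2
  have h1 : (-1 : K) ≠ 0 := neg_ne_zero.2 one_ne_zero
  rw [neg_eq_neg_one_mul a, neg_eq_neg_one_mul b, neg_eq_neg_one_mul (a * b),
    neg_eq_neg_one_mul (a / b)]
  simp only [mul_zpow, div_zpow, zpow_add₀ h1, zpow_add₀ ha, zpow_add₀ hb, zpow_sub₀ hb]
  field_simp

omit [IsTopologicalRing K] [T2Space K] in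
theorem hasSum_ite_of_parametrization {ι κ : Type*} {g : κ → K⟦X⟧} {φ : ι → κ} {p : κ → Prop}
    [DecidablePred p] (hφ : φ.Injective) (hp : ∀ w, p (φ w)) (hp' : ∀ v, p v → ∃ w, φ w = v)
    {s : K⟦X⟧} (h : HasSum (fun w ↦ g (φ w)) s) : HasSum (fun v ↦ if p v then g v else 0) s := by
  refine (hφ.hasSum_iff fun v hv ↦ if_neg fun h ↦ hv (hp' v h)).1 (h.of_eq (fun w ↦ ?_) rfl)
  simp [hp w]

theorem hasSum_ite_zero_of_involutive [CharZero K] {ι : Type*} {c : ι → K} {e : ι → ℕ}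
    (he : ∀ N, {i | e i ≤ N}.Finite) {σ : ι → ι} (hσ : σ.Involutive) {p : ι → Prop}
    [DecidablePred p] (hp : ∀ v, p (σ v) ↔ p v) (hc : ∀ v, p v → c (σ v) = -c v)
    (hs : ∀ v, p v → e (σ v) = e v) :
    HasSum (fun v ↦ if p v then C (c v) * X ^ e v else (0 : K⟦X⟧)) 0 := by
  have hsum : Summable fun v ↦ if p v then C (c v) * X ^ e v else (0 : K⟦X⟧) := by
    refine (summable_C_mul_X_pow (fun v ↦ if p v then c v else 0) he).congr fun v ↦ ?_
    split_ifs <;> simp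
  have h1 := hsum.hasSum
  have h2 := (hσ.toPerm.hasSum_iff.2 h1).of_eq
    (g := fun v ↦ -(if p v then C (c v) * X ^ e v else (0 : K⟦X⟧)))
    (fun v ↦ by
      by_cases hv : p v
      · simp [hp, hv, hc v hv, hs v hv]
      · simp [hp, hv]) rfl
  have h3 := h2.unique h1.neg
  have h4 : ∑' v, (if p v then C (c v) * X ^ e v else (0 : K⟦X⟧)) = 0 := by
    ext d
    have := congrArg (coeff d) h3
    rw [map_neg, self_eq_neg] at this
    simpa using this
  rwa [h4] at h1

/-- The theta series `∑ (-1) ^ x a ^ (3 x) q ^ (3 x (x - 1) / 2)`. -/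
noncomputable def cubicTheta (a : K) : K⟦X⟧ :=
  ∑' x : ℤ, C ((-1) ^ x * a ^ (3 * x)) * X ^ (3 * triangular x)

/-- The theta series `∑ (-1) ^ y b ^ (3 y) q ^ (y (3 y - 1) / 2)`. -/
noncomputable def pentagonalTheta (b : K) : K⟦X⟧ :=
  ∑' y : ℤ, C ((-1) ^ y * b ^ (3 * y)) * X ^ pentagonal y

theorem finite_three_mul_triangular_le (N : ℕ) : {j : ℤ | 3 * triangular j ≤ N}.Finite :=
  (finite_triangular_le N).subset fun j (hj : 3 * triangular j ≤ N) ↦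
    show triangular j ≤ N by omega

omit [IsTopologicalRing K] [T2Space K] in
theorem hasSum_qPochInf_one :
    HasSum (fun k : ℤ ↦ C ((-1 : K) ^ k) * X ^ pentagonal k) (qPochInf (1 : K)) := by
  rw [qPochInf_one_eq_pentagonalSeries]
  refine (WithPiTopology.hasSum_pentagonalSeries K).of_eq (fun k ↦ ?_) rfl
  congr 1
  rcases Int.even_or_odd k with h | h <;>
    simp [h.neg_one_zpow, Int.negOnePow_even, Int.negOnePow_odd, h]

omit [TopologicalSpace K] [IsTopologicalRing K] [T2Space K] in
theorem neg_one_zpow_congr {m n : ℤ} (h : Even (m - n)) : (-1 : K) ^ m = (-1) ^ n := by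
  rw [← sub_add_cancel m n, zpow_add₀ (neg_ne_zero.2 one_ne_zero), h.neg_one_zpow, one_mul]

omit [TopologicalSpace K] [IsTopologicalRing K] [T2Space K] in
theorem neg_one_zpow_congr_neg {m n : ℤ} (h : Odd (m - n)) : (-1 : K) ^ m = -(-1) ^ n := by
  rw [← sub_add_cancel m n, zpow_add₀ (neg_ne_zero.2 one_ne_zero), h.neg_one_zpow, neg_one_mul]

theorem hasSum_winquist_product (a b : K) :
    HasSum (fun w : ℤ × ℤ × ℤ × ℤ ↦ C (((-1) ^ w.1 * a ^ (3 * w.1)) * (((-1) ^ w.2.1 *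
      b ^ (3 * w.2.1)) * ((-1) ^ w.2.2.1 * (-1) ^ w.2.2.2))) * X ^ (3 * triangular w.1 +
        (pentagonal w.2.1 + (pentagonal w.2.2.1 + pentagonal w.2.2.2))))
      (cubicTheta a * (pentagonalTheta b * (qPochInf 1 * qPochInf 1))) :=
  hasSum_C_mul_X_pow_mul_four (c₁ := fun x ↦ (-1) ^ x * a ^ (3 * x))
    (e₁ := fun x ↦ 3 * triangular x) (c₂ := fun y ↦ (-1) ^ y * b ^ (3 * y))
    (c₃ := fun y ↦ (-1) ^ y) (c₄ := fun y ↦ (-1) ^ y) finite_three_mul_triangular_le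
    finite_pentagonal_le finite_pentagonal_le finite_pentagonal_le
    (summable_C_mul_X_pow _ finite_three_mul_triangular_le).hasSum
    (summable_C_mul_X_pow _ finite_pentagonal_le).hasSum hasSum_qPochInf_one hasSum_qPochInf_one

/-- The linear substitution diagonalising the exponent of the product of four theta series. -/
def winquistParam (w : ℤ × ℤ × ℤ × ℤ) : ℤ × ℤ × ℤ × ℤ :=
  (w.1 + w.2.2.1 - w.2.2.2, w.2.1 + w.2.2.1 + w.2.2.2, w.1 + w.2.1 - w.2.2.1,
    w.1 - w.2.1 + w.2.2.2)

/-- The symmetry of the product of four theta series under `b ↦ 1 / b`. -/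
def winquistInv (v : ℤ × ℤ × ℤ × ℤ) : ℤ × ℤ × ℤ × ℤ := (v.1, 1 - v.2.1, v.2.2.2, v.2.2.1)

/-- The symmetry of the product of four theta series under exchanging `a` and `b`. -/
def winquistSwap (v : ℤ × ℤ × ℤ × ℤ) : ℤ × ℤ × ℤ × ℤ := (v.2.1, v.1, v.2.2.1, 1 - v.2.2.2)

theorem triangular_one_sub (j : ℤ) : triangular (1 - j) = triangular j := by
  rw [triangular, triangular]
  congr 2
  ring

omit [TopologicalSpace K] [IsTopologicalRing K] [T2Space K] in
theorem winquistTerm_param {a b : K} (w : ℤ × ℤ × ℤ × ℤ) :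
    (C (winquistCoeff a b (winquistParam w)) * X ^ winquistExp (winquistParam w) : K⟦X⟧) =
      C (((-1) ^ w.1 * a ^ (3 * w.1)) * (((-1) ^ w.2.1 *
      b ^ (3 * w.2.1)) * ((-1) ^ w.2.2.1 * (-1) ^ w.2.2.2))) * X ^ (3 * triangular w.1 +
        (pentagonal w.2.1 + (pentagonal w.2.2.1 + pentagonal w.2.2.2))) := by
  obtain ⟨x, y, k, l⟩ := w
  congr 2
  · have h1 : (-1 : K) ≠ 0 := neg_ne_zero.2 one_ne_zero
    have hs : (-1 : K) ^ (x + k - l + (y + k + l) + (x + y - k) + (x - y + l)) =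
        (-1) ^ (x + y + k + l) := neg_one_zpow_congr ⟨x, by ring⟩
    simp only [winquistCoeff, winquistParam]
    rw [hs, show x + k - l + (x + y - k) + (x - y + l) = 3 * x by ring,
      show y + k + l + (x + y - k) - (x - y + l) = 3 * y by ring, zpow_add₀ h1, zpow_add₀ h1,
      zpow_add₀ h1]
    ring
  · simp only [winquistExp, winquistParam]
    have := two_mul_triangular (x + k - l)
    have := two_mul_triangular (y + k + l)
    have := two_mul_triangular (x + y - k)
    have := two_mul_triangular (x - y + l)
    have := two_mul_triangular x
    have := two_mul_natCast_pentagonal y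
    have := two_mul_natCast_pentagonal k
    have := two_mul_natCast_pentagonal l
    zify
    linarith

omit [TopologicalSpace K] [IsTopologicalRing K] [T2Space K] in
theorem winquistTerm_inv {a b : K} (hb : b ≠ 0) (v : ℤ × ℤ × ℤ × ℤ) :
    (C (winquistCoeff a b (winquistInv v)) * X ^ winquistExp (winquistInv v) : K⟦X⟧) =
      -C b * (C (winquistCoeff a b⁻¹ v) * X ^ winquistExp v) := by
  obtain ⟨i, j, k, l⟩ := v
  have he : winquistExp (winquistInv (i, j, k, l)) = winquistExp (i, j, k, l) := by
    simp only [winquistExp, winquistInv, triangular_one_sub]; ring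
  have hc : winquistCoeff a b (winquistInv (i, j, k, l)) =
      -b * winquistCoeff a b⁻¹ (i, j, k, l) := by
    simp only [winquistCoeff, winquistInv]
    rw [neg_one_zpow_congr_neg (n := i + j + k + l) ⟨-j, by ring⟩,
      show i + l + k = i + k + l by ring, show 1 - j + l - k = 1 + -(j + k - l) by ring,
      zpow_add₀ hb, inv_zpow', zpow_one]
    ring
  rw [he, hc, map_mul, map_neg, mul_assoc]

omit [TopologicalSpace K] [IsTopologicalRing K] [T2Space K] in
theorem winquistTerm_swap {a b : K} (ha : a ≠ 0) (hb : b ≠ 0) (v : ℤ × ℤ × ℤ × ℤ) :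
    (C (winquistCoeff a b (winquistSwap v)) * X ^ winquistExp (winquistSwap v) : K⟦X⟧) =
      -C (a / b) * (C (winquistCoeff b a v) * X ^ winquistExp v) := by
  obtain ⟨i, j, k, l⟩ := v
  have he : winquistExp (winquistSwap (i, j, k, l)) = winquistExp (i, j, k, l) := by
    simp only [winquistExp, winquistSwap, triangular_one_sub]; ring
  have hc : winquistCoeff a b (winquistSwap (i, j, k, l)) =
      -(a / b) * winquistCoeff b a (i, j, k, l) := by
    simp only [winquistCoeff, winquistSwap]
    rw [neg_one_zpow_congr_neg (n := i + j + k + l) ⟨-l, by ring⟩,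
      show j + k + (1 - l) = 1 + (j + k - l) by ring,
      show i + k - (1 - l) = -1 + (i + k + l) by ring,
      zpow_add₀ hb, zpow_add₀ ha, zpow_one, zpow_neg_one]
    ring
  rw [he, hc, map_mul, map_neg, mul_assoc]

theorem winquistParam_injective : winquistParam.Injective := by
  rintro ⟨x, y, k, l⟩ ⟨x', y', k', l'⟩ h
  simp only [winquistParam, Prod.mk.injEq] at h ⊢
  omega

theorem winquistInv_involutive : winquistInv.Involutive := by
  rintro ⟨i, j, k, l⟩
  simp [winquistInv]

theorem winquistSwap_involutive : winquistSwap.Involutive := by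
  rintro ⟨i, j, k, l⟩
  simp [winquistSwap]

/-- The exponents of `a` and `b` lie in prescribed residue classes modulo three. -/
abbrev WinquistClass (r s : ℤ) (v : ℤ × ℤ × ℤ × ℤ) : Prop :=
  (v.1 + v.2.2.1 + v.2.2.2) % 3 = r ∧ (v.2.1 + v.2.2.1 - v.2.2.2) % 3 = s

theorem winquistClass_zero_zero_iff (v : ℤ × ℤ × ℤ × ℤ) :
    WinquistClass 0 0 v ↔ ∃ w, winquistParam w = v := by
  obtain ⟨i, j, k, l⟩ := v
  constructor
  · rintro ⟨h1, h2⟩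
    simp only at h1 h2
    obtain ⟨x, hx⟩ := Int.dvd_of_emod_eq_zero h1
    obtain ⟨y, hy⟩ := Int.dvd_of_emod_eq_zero h2
    refine ⟨(x, y, x + y - k, l - x + y), ?_⟩
    simp only [winquistParam, Prod.mk.injEq]
    omega
  · rintro ⟨⟨x, y, k, l⟩, hw⟩
    simp only [winquistParam, Prod.mk.injEq] at hw
    simp only [WinquistClass]
    omega

theorem winquistClass_inv_iff (v : ℤ × ℤ × ℤ × ℤ) :
    WinquistClass 0 0 (winquistInv v) ↔ WinquistClass 0 1 v := by
  simp only [WinquistClass, winquistInv]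
  omega

theorem winquistClass_swap_iff (v : ℤ × ℤ × ℤ × ℤ) :
    WinquistClass 0 0 (winquistSwap v) ↔ WinquistClass 1 2 v := by
  simp only [WinquistClass, winquistSwap]
  omega

theorem winquistClass_inv_swap_iff (v : ℤ × ℤ × ℤ × ℤ) :
    WinquistClass 0 0 (winquistInv (winquistSwap v)) ↔ WinquistClass 2 2 v := by
  simp only [WinquistClass, winquistSwap, winquistInv]
  omega

theorem hasSum_winquistClass_zero_zero (a b : K) :
    HasSum (fun v ↦ if WinquistClass 0 0 v then C (winquistCoeff a b v) * X ^ winquistExp v else 0)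
      (cubicTheta a * (pentagonalTheta b * (qPochInf 1 * qPochInf 1))) :=
  hasSum_ite_of_parametrization winquistParam_injective
    (fun w ↦ (winquistClass_zero_zero_iff _).2 ⟨w, rfl⟩)
    (fun v ↦ (winquistClass_zero_zero_iff v).1)
    ((hasSum_winquist_product a b).of_eq winquistTerm_param rfl)

theorem hasSum_winquistClass_zero_one (a : K) {b : K} (hb : b ≠ 0) :
    HasSum (fun v ↦ if WinquistClass 0 1 v then C (winquistCoeff a b v) * X ^ winquistExp v else 0)
      (-C b * (cubicTheta a * (pentagonalTheta b⁻¹ * (qPochInf 1 * qPochInf 1)))) := by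
  have h := winquistInv_involutive.toPerm.hasSum_iff.2 (hasSum_winquistClass_zero_zero a b⁻¹)
  refine (h.mul_left (-C b)).of_eq (fun v ↦ ?_) rfl
  have := winquistTerm_inv (a := a) hb (winquistInv v)
  rw [winquistInv_involutive] at this
  simp only [Function.comp_apply, Function.Involutive.coe_toPerm, winquistClass_inv_iff, this,
    mul_ite, mul_zero]

theorem hasSum_winquistClass_one_two {a b : K} (ha : a ≠ 0) (hb : b ≠ 0) :
    HasSum (fun v ↦ if WinquistClass 1 2 v then C (winquistCoeff a b v) * X ^ winquistExp v else 0)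
      (-C (a / b) * (cubicTheta b * (pentagonalTheta a * (qPochInf 1 * qPochInf 1)))) := by
  have h := winquistSwap_involutive.toPerm.hasSum_iff.2 (hasSum_winquistClass_zero_zero b a)
  refine (h.mul_left (-C (a / b))).of_eq (fun v ↦ ?_) rfl
  have := winquistTerm_swap ha hb (winquistSwap v)
  rw [winquistSwap_involutive] at this
  simp only [Function.comp_apply, Function.Involutive.coe_toPerm, winquistClass_swap_iff, this,
    mul_ite, mul_zero]

theorem hasSum_winquistClass_two_two {a b : K} (ha : a ≠ 0) (hb : b ≠ 0) :
    HasSum (fun v ↦ if WinquistClass 2 2 v then C (winquistCoeff a b v) * X ^ winquistExp v else 0)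
      (-C (a / b) * (-C a * (cubicTheta b *
        (pentagonalTheta a⁻¹ * (qPochInf 1 * qPochInf 1))))) := by
  have h := winquistSwap_involutive.toPerm.hasSum_iff.2 (hasSum_winquistClass_zero_one b ha)
  refine (h.mul_left (-C (a / b))).of_eq (fun v ↦ ?_) rfl
  have := winquistTerm_swap ha hb (winquistSwap v)
  rw [winquistSwap_involutive] at this
  simp only [Function.comp_apply, Function.Involutive.coe_toPerm, ← winquistClass_inv_iff,
    winquistClass_inv_swap_iff, this, mul_ite, mul_zero]

/-- The shift amount in the sign-reversing involution `winquistAdd`. -/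
def winquistAddShift (v : ℤ × ℤ × ℤ × ℤ) : ℤ :=
  (2 * (v.1 + v.2.1 + 2 * v.2.2.1) - 1) / 3 - 2 * v.2.2.1

/-- A sign-reversing involution cancelling terms of the product of four theta series. -/
def winquistAdd (v : ℤ × ℤ × ℤ × ℤ) : ℤ × ℤ × ℤ × ℤ :=
  (v.1 - winquistAddShift v, v.2.1 - winquistAddShift v, v.2.2.1 + winquistAddShift v, v.2.2.2)

theorem hasSum_winquist_add_class [CharZero K] (a b : K) :
    HasSum (fun v ↦ if (v.1 + v.2.1 + 2 * v.2.2.1) % 3 = 2 then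
      C (winquistCoeff a b v) * X ^ winquistExp v else (0 : K⟦X⟧)) 0 := by
  refine hasSum_ite_zero_of_involutive finite_winquistExp_le (σ := winquistAdd) ?_ ?_ ?_ ?_
  · rintro ⟨i, j, k, l⟩
    simp only [winquistAdd, winquistAddShift, Prod.mk.injEq, and_true]
    refine ⟨?_, ?_, ?_⟩ <;> omega
  · rintro ⟨i, j, k, l⟩
    simp only [winquistAdd, winquistAddShift]
    omega
  · rintro ⟨i, j, k, l⟩ h
    have hd : Odd (winquistAddShift (i, j, k, l)) := by
      simp only [winquistAddShift, Int.odd_iff] at h ⊢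
      omega
    simp only [winquistCoeff, winquistAdd, ← neg_mul]
    have hs (d : ℤ) (hd : Odd d) :
        (-1 : K) ^ (i - d + (j - d) + (k + d) + l) = -(-1) ^ (i + j + k + l) :=
      neg_one_zpow_congr_neg (by
        rwa [show i - d + (j - d) + (k + d) + l - (i + j + k + l) = -d by ring, odd_neg])
    rw [hs _ hd]
    congr 3 <;> ring
  · rintro ⟨i, j, k, l⟩ h
    obtain ⟨d, hd⟩ : ∃ d, winquistAddShift (i, j, k, l) = d := ⟨_, rfl⟩
    have hd' : 3 * d = 2 * (i + j + 2 * k) - 1 - 6 * k := by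
      simp only [winquistAddShift] at hd h
      omega
    simp only [winquistExp, winquistAdd, hd]
    have e1 := two_mul_triangular (i - d)
    have e2 := two_mul_triangular (j - d)
    have e3 := two_mul_triangular (k + d)
    have e4 := two_mul_triangular i
    have e5 := two_mul_triangular j
    have e6 := two_mul_triangular k
    have : 2 * (triangular (i - d) + triangular (j - d) + triangular (k + d) : ℤ) =
        2 * (triangular i + triangular j + triangular k) := by
      linear_combination e1 + e2 + e3 - e4 - e5 - e6 + d * hd'
    omega

/-- The shift amount in the sign-reversing involution `winquistSub`. -/
def winquistSubShift (v : ℤ × ℤ × ℤ × ℤ) : ℤ :=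
  (2 * (v.1 - v.2.1 + 2 * v.2.2.2) + 1) / 3 - 2 * v.2.2.2

/-- A sign-reversing involution cancelling terms of the product of four theta series. -/
def winquistSub (v : ℤ × ℤ × ℤ × ℤ) : ℤ × ℤ × ℤ × ℤ :=
  (v.1 - winquistSubShift v, v.2.1 + winquistSubShift v, v.2.2.1, v.2.2.2 + winquistSubShift v)

theorem hasSum_winquist_sub_class [CharZero K] (a b : K) :
    HasSum (fun v ↦ if (v.1 - v.2.1 + 2 * v.2.2.2) % 3 = 1 ∧
        (v.1 + v.2.1 + 2 * v.2.2.1) % 3 ≠ 2 then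
      C (winquistCoeff a b v) * X ^ winquistExp v else (0 : K⟦X⟧)) 0 := by
  refine hasSum_ite_zero_of_involutive finite_winquistExp_le (σ := winquistSub) ?_ ?_ ?_ ?_
  · rintro ⟨i, j, k, l⟩
    simp only [winquistSub, winquistSubShift, Prod.mk.injEq, true_and]
    refine ⟨?_, ?_, ?_⟩ <;> omega
  · rintro ⟨i, j, k, l⟩
    simp only [winquistSub, winquistSubShift]
    omega
  · rintro ⟨i, j, k, l⟩ h
    have hd : Odd (winquistSubShift (i, j, k, l)) := by
      simp only [winquistSubShift, Int.odd_iff] at h ⊢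
      omega
    simp only [winquistCoeff, winquistSub, ← neg_mul]
    have hs (d : ℤ) (hd : Odd d) :
        (-1 : K) ^ (i - d + (j + d) + k + (l + d)) = -(-1) ^ (i + j + k + l) :=
      neg_one_zpow_congr_neg (by convert hd using 1; ring)
    rw [hs _ hd]
    congr 3 <;> ring
  · rintro ⟨i, j, k, l⟩ h
    obtain ⟨d, hd⟩ : ∃ d, winquistSubShift (i, j, k, l) = d := ⟨_, rfl⟩
    have hd' : 3 * d = 2 * (i - j + 2 * l) + 1 - 6 * l := by
      simp only [winquistSubShift] at hd h
      omega
    simp only [winquistExp, winquistSub, hd]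
    have e1 := two_mul_triangular (i - d)
    have e2 := two_mul_triangular (j + d)
    have e3 := two_mul_triangular (l + d)
    have e4 := two_mul_triangular i
    have e5 := two_mul_triangular j
    have e6 := two_mul_triangular l
    have : 2 * (triangular (i - d) + triangular (j + d) + triangular (l + d) : ℤ) =
        2 * (triangular i + triangular j + triangular l) := by
      linear_combination e1 + e2 + e3 - e4 - e5 - e6 + d * hd'
    omega

/-- **Winquist's identity**, multiplied by the square of `(q; q)_∞`. -/
theorem winquist_identity [CharZero K] {a b : K} (ha : a ≠ 0) (hb : b ≠ 0) :
    thetaProd a * (thetaProd b * (thetaProd (a * b) * thetaProd (a / b))) =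
      qPochInf 1 ^ 2 * (cubicTheta a * (pentagonalTheta b - C b * pentagonalTheta b⁻¹) -
        C (a / b) * (cubicTheta b * (pentagonalTheta a - C a * pentagonalTheta a⁻¹))) := by
  have h := (((((hasSum_winquistClass_zero_zero a b).add (hasSum_winquistClass_zero_one a hb)).add
    (hasSum_winquistClass_one_two ha hb)).add (hasSum_winquistClass_two_two ha hb)).add
    (hasSum_winquist_add_class a b)).add (hasSum_winquist_sub_class a b)
  rw [(hasSum_thetaProd_mul ha hb).unique (h.of_eq (fun v ↦ ?_) rfl)]
  · ring
  · obtain ⟨i, j, k, l⟩ := v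
    generalize C (winquistCoeff a b (i, j, k, l)) * X ^ winquistExp (i, j, k, l) = t
    simp only [WinquistClass]
    have hu : (i + k + l) % 3 = 0 ∨ (i + k + l) % 3 = 1 ∨ (i + k + l) % 3 = 2 := by omega
    have hv : (j + k - l) % 3 = 0 ∨ (j + k - l) % 3 = 1 ∨ (j + k - l) % 3 = 2 := by omega
    have ha : (i + j + 2 * k) % 3 = ((i + k + l) % 3 + (j + k - l) % 3) % 3 := by omega
    have hs : (i - j + 2 * l) % 3 = ((i + k + l) % 3 - (j + k - l) % 3) % 3 := by omega
    rcases hu with hu | hu | hu <;> rcases hv with hv | hv | hv <;> simp [ha, hs, hu, hv]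

end Winquist

section CrankSeries

variable {K : Type*} [Field K]

theorem tendsto_prod_of_eventually [TopologicalSpace K] [IsTopologicalRing K] {w : ℕ → K} {z : K}
    {L : ℕ} (hw : ∀ i, L < i → w i = z) :
    Tendsto (fun n ↦ ∏ i ∈ Finset.range n, (1 - C (w (i + 1)) * X ^ (i + 1) : K⟦X⟧)) atTop
      (𝓝 ((∏ i ∈ Finset.range L, (1 - C (w (i + 1)) * X ^ (i + 1))) * (qPoch z L)⁻¹ *
        qPochInf z)) := by
  refine ((tendsto_qPoch z).const_mul _).congr' (eventually_atTop.2 ⟨L, fun n hn ↦ ?_⟩)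
  induction n, hn using Nat.le_induction with
  | base =>
    linear_combination (∏ i ∈ Finset.range L, (1 - C (w (i + 1)) * X ^ (i + 1))) *
      qPoch_mul_inv z L
  | succ n hn ih =>
    beta_reduce at ih ⊢
    rw [Finset.prod_range_succ, ← ih, qPoch_succ, hw (n + 1) (by omega), mul_assoc, mul_assoc,
      mul_assoc]

theorem one_add_tsum_pow_mul [TopologicalSpace K] [IsTopologicalRing K] [T2Space K] (w : K)
    (i : ℕ) :
    (1 + ∑' j, w ^ (j + 1) • X ^ ((i + 1) * (j + 1))) * (1 - C w * X ^ (i + 1) : K⟦X⟧) = 1 := by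
  have h : ∀ j, w ^ (j + 1) • (X : K⟦X⟧) ^ ((i + 1) * (j + 1)) = (C w * X ^ (i + 1)) ^ (j + 1) := by
    intro j
    rw [smul_eq_C_mul, map_pow, mul_pow, pow_mul]
  have hd : ∀ j, (X : K⟦X⟧) ^ j ∣ (C w * X ^ (i + 1)) ^ j := fun j ↦
    pow_dvd_pow_of_dvd (Dvd.dvd.mul_left (dvd_pow_self X (by omega)) _) j
  have := (summable_of_X_pow_dvd hd).tsum_eq_zero_add
  simp_rw [h]
  rw [pow_zero] at this
  rw [← this]
  exact WithPiTopology.tsum_pow_mul_one_sub_of_constantCoeff_eq_zero (by simp)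

/-- The multiplicity weight giving `u c` to `c` ones and `z` to every part larger than `L`. -/
noncomputable def crankWeight (u : ℕ → K) (z : K) (L i c : ℕ) : K :=
  if i = 1 then u c else (if i ≤ L then 1 else z) ^ c

theorem genFun_crankWeight_mul [TopologicalSpace K] [IsTopologicalRing K] [T2Space K]
    (u : ℕ → K) (z : K) {L : ℕ} (hL : 1 ≤ L) :
    Nat.Partition.genFun (crankWeight u z L) * (qPoch 1 L * (qPoch z L)⁻¹ * qPochInf z) =
      (1 + ∑' c, u (c + 1) • X ^ (c + 1)) * (1 - X) := by
  obtain ⟨w, hw⟩ : ∃ w : ℕ → K, w = fun i ↦ if i ≤ L then 1 else z := ⟨_, rfl⟩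
  have hP := tendsto_prod_of_eventually (w := w) (z := z) (L := L) fun i hi ↦ by
    rw [hw]; exact if_neg (by omega)
  have hw1 : ∀ i ∈ Finset.range L, (1 - C (w (i + 1)) * X ^ (i + 1) : K⟦X⟧) =
      1 - C 1 * X ^ (i + 1) := by
    intro i hi
    have := Finset.mem_range.1 hi
    rw [hw]
    simp only [show i + 1 ≤ L by omega, if_true]
  rw [Finset.prod_congr rfl hw1] at hP
  have h1 := (Nat.Partition.hasProd_genFun (crankWeight u z L)).tendsto_prod_nat.mul hP
  have h2 := (tendsto_add_atTop_iff_nat 1).2 h1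
  refine tendsto_nhds_unique h2 (tendsto_const_nhds.congr fun n ↦ ?_)
  rw [← Finset.prod_mul_distrib, Finset.prod_range_succ', Finset.prod_eq_one]
  · simp [crankWeight, hw, hL]
  · intro i _
    have h3 : ∀ c, crankWeight u z L (i + 1 + 1) (c + 1) = w (i + 1 + 1) ^ (c + 1) := fun c ↦ by
      rw [crankWeight, if_neg (by omega), hw]
    simp_rw [h3]
    exact one_add_tsum_pow_mul (w (i + 2)) (i + 1)

theorem prod_map_ite_eq_pow (z : K) (L : ℕ) (s : Multiset ℕ) :
    (s.map fun i ↦ if i ≤ L then 1 else z).prod = z ^ (s.filter (L < ·)).card := by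
  induction s using Multiset.induction with
  | empty => simp
  | cons a s ih =>
    rw [Multiset.map_cons, Multiset.prod_cons, ih]
    by_cases h : a ≤ L
    · simp [h, not_lt.2 h]
    · simp [h, not_le.1 h, pow_succ']

theorem coeff_genFun_crankWeight (u : ℕ → K) (z : K) {L : ℕ} (hL : 1 ≤ L) (n : ℕ) :
    coeff n (Nat.Partition.genFun (crankWeight u z L)) = ∑ p : n.Partition,
      (if p.parts.count 1 = 0 then 1 else u (p.parts.count 1)) *
        z ^ (p.parts.filter (L < ·)).card := by
  rw [Nat.Partition.coeff_genFun]
  refine Finset.sum_congr rfl fun p _ ↦ ?_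
  have h : ∀ i c, crankWeight u z L i c =
      (if i = 1 then u c else 1) * (if i ≤ L then 1 else z) ^ c := by
    intro i c
    rw [crankWeight]
    split_ifs <;> first | omega | simp
  simp_rw [Finsupp.prod, h]
  rw [Finset.prod_mul_distrib, ← prod_map_ite_eq_pow, Finset.prod_multiset_map_count]
  congr 1
  · simp only [Multiset.toFinsupp_support, Multiset.toFinsupp_apply]
    rw [Finset.prod_ite_eq' p.parts.toFinset 1 fun i ↦ u (p.parts.count i)]
    simp [Multiset.count_eq_zero]

/-- The generating function of partitions without ones and with largest part `L`. -/
noncomputable def noOnesSeries (K : Type*) [Field K] (L : ℕ) : K⟦X⟧ :=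
  mk fun n ↦ ∑ p : n.Partition, if p.parts.count 1 = 0 ∧ p.parts.sup = L then 1 else 0

/-- The generating function of the crank over partitions with exactly `j` ones. -/
noncomputable def onesSeries (z : K) (j : ℕ) : K⟦X⟧ :=
  mk fun n ↦ ∑ p : n.Partition,
    if p.parts.count 1 = j then z ^ ((p.parts.filter (j < ·)).card - j : ℤ) else 0

theorem coeff_genFun_crankWeight_zero {L : ℕ} (hL : 1 ≤ L) (n : ℕ) :
    coeff n (Nat.Partition.genFun (crankWeight (fun _ ↦ 0) (0 : K) L)) =
      ∑ p : n.Partition, if p.parts.count 1 = 0 ∧ p.parts.sup ≤ L then 1 else 0 := by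
  rw [coeff_genFun_crankWeight _ _ hL]
  refine Finset.sum_congr rfl fun p _ ↦ ?_
  simp only [ite_and, zero_pow_eq, Multiset.card_eq_zero, Multiset.filter_eq_nil, not_lt,
    Multiset.sup_le, ite_mul, one_mul, zero_mul]

variable [TopologicalSpace K] [IsTopologicalRing K] [T2Space K]

theorem genFun_crankWeight_zero {L : ℕ} (hL : 1 ≤ L) :
    Nat.Partition.genFun (crankWeight (fun _ ↦ 0) (0 : K) L) = (1 - X) * (qPoch 1 L)⁻¹ := by
  have h := genFun_crankWeight_mul (fun _ ↦ 0) (0 : K) hL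
  have h0 : qPoch (0 : K) L = 1 := by simp [qPoch]
  simp only [qPochInf_zero, h0, inv_one, mul_one, zero_smul, tsum_zero, add_zero, one_mul] at h
  rw [← h, mul_assoc, qPoch_mul_inv, mul_one]

theorem count_one_eq_zero_and_sup_le_one_iff {n : ℕ} (p : n.Partition) :
    p.parts.count 1 = 0 ∧ p.parts.sup ≤ 1 ↔ p.parts.count 1 = 0 ∧ p.parts.sup = 0 := by
  refine and_congr_right fun h1 ↦ ⟨fun h2 ↦ ?_, fun h2 ↦ by omega⟩
  rw [← Nat.le_zero, Multiset.sup_le]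
  intro i hi
  have := Multiset.sup_le.1 h2 i hi
  have := p.parts_pos hi
  have : i ≠ 1 := fun h ↦ Multiset.count_eq_zero.1 h1 (h ▸ hi)
  omega

theorem noOnesSeries_zero : noOnesSeries K 0 = 1 := by
  have h := genFun_crankWeight_zero (K := K) le_rfl
  rw [show (1 - X : K⟦X⟧) = qPoch 1 1 by simp [qPoch], qPoch_mul_inv] at h
  rw [← h]
  ext n
  rw [coeff_genFun_crankWeight_zero le_rfl, noOnesSeries, coeff_mk]
  simp_rw [count_one_eq_zero_and_sup_le_one_iff]

omit [TopologicalSpace K] [IsTopologicalRing K] [T2Space K] in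
theorem noOnesSeries_one : noOnesSeries K 1 = 0 := by
  ext n
  rw [noOnesSeries, coeff_mk]
  refine Finset.sum_eq_zero fun p _ ↦ if_neg fun h ↦ ?_
  have := (count_one_eq_zero_and_sup_le_one_iff p).1 ⟨h.1, h.2.le⟩
  omega

theorem noOnesSeries_succ {L : ℕ} (hL : 1 ≤ L) :
    noOnesSeries K (L + 1) = (1 - X) * (qPoch 1 (L + 1))⁻¹ * X ^ (L + 1) := by
  have h : noOnesSeries K (L + 1) = Nat.Partition.genFun (crankWeight (fun _ ↦ 0) 0 (L + 1)) -
      Nat.Partition.genFun (crankWeight (fun _ ↦ 0) 0 L) := by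
    ext n
    rw [map_sub, coeff_genFun_crankWeight_zero hL, coeff_genFun_crankWeight_zero (by omega),
      ← Finset.sum_sub_distrib, noOnesSeries, coeff_mk]
    refine Finset.sum_congr rfl fun p _ ↦ ?_
    by_cases h1 : p.parts.count 1 = 0
    · rcases lt_trichotomy p.parts.sup (L + 1) with h | h | h
      · simp [h1, h.ne, h.le, Nat.le_of_lt_succ h]
      · simp [h1, h]
      · simp [h1, h.ne', not_le.2 h, show ¬ p.parts.sup ≤ L by omega]
    · simp [h1]
  rw [h, genFun_crankWeight_zero hL, genFun_crankWeight_zero (by omega), inv_qPoch_eq 1 L, map_one]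
  ring

theorem onesSeries_eq {z : K} (hz : z ≠ 0) {j : ℕ} (hj : 1 ≤ j) :
    onesSeries z j = (1 - X) * (qPochInf z)⁻¹ * qBinomTerm z z⁻¹ 1 j := by
  have h : onesSeries z j = C (z⁻¹ ^ j) *
      (Nat.Partition.genFun (crankWeight (fun c ↦ if c = j then 1 else 0) z j) -
        Nat.Partition.genFun (crankWeight (fun _ ↦ 0) z j)) := by
    ext n
    rw [coeff_C_mul, map_sub, coeff_genFun_crankWeight _ _ hj, coeff_genFun_crankWeight _ _ hj,
      ← Finset.sum_sub_distrib, Finset.mul_sum, onesSeries, coeff_mk]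
    refine Finset.sum_congr rfl fun p _ ↦ ?_
    rw [← sub_mul]
    by_cases h0 : p.parts.count 1 = 0
    · simp [h0, show ¬ 0 = j by omega]
    · by_cases h1 : p.parts.count 1 = j
      · simp [h1, zpow_sub₀ hz, show j ≠ 0 by omega]
        ring
      · simp [h0, h1]
  have h1 := genFun_crankWeight_mul (fun c ↦ if c = j then 1 else 0) z hj
  have h2 := genFun_crankWeight_mul (fun _ ↦ 0) z hj
  have h3 : ∑' c, (if c + 1 = j then (1 : K) else 0) • (X : K⟦X⟧) ^ (c + 1) = X ^ j := by
    rw [tsum_eq_single (j - 1)]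
    · simp [show j - 1 + 1 = j by omega]
    · intro c hc
      rw [if_neg (by omega), zero_smul]
  rw [h3] at h1
  simp only [zero_smul, tsum_zero, add_zero, one_mul] at h2
  rw [h, qBinomTerm, one_mul]
  set A := Nat.Partition.genFun (crankWeight (fun c ↦ if c = j then 1 else 0) z j)
  set B := Nat.Partition.genFun (crankWeight (fun _ ↦ 0) z j)
  have key : (A - B) * (qPoch 1 j * (qPoch z j)⁻¹ * qPochInf z) = X ^ j * (1 - X) := by
    linear_combination h1 - h2
  have key2 : A - B = X ^ j * (1 - X) * ((qPoch 1 j)⁻¹ * qPoch z j * (qPochInf z)⁻¹) := by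
    rw [← key]
    linear_combination -(A - B) * (qPochInf_mul_inv z) -
      (A - B) * (qPochInf z * (qPochInf z)⁻¹) * qPoch_mul_inv z j -
      (A - B) * (qPochInf z * (qPochInf z)⁻¹) * (qPoch z j * (qPoch z j)⁻¹) *
        qPoch_mul_inv (1 : K) j
  rw [key2]
  ring

/-- The generating function of the crank. -/
noncomputable def crankSeries (z : K) : K⟦X⟧ :=
  mk fun n ↦ ∑ p : n.Partition, z ^ partitionCrank p

/-- The contribution to the crank generating function of partitions with either no ones and
largest part `L`, or exactly `L` ones. -/
noncomputable def crankTerm (z : K) (L : ℕ) : K⟦X⟧ :=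
  C (z ^ L) * noOnesSeries K L + if L = 0 then 0 else onesSeries z L

omit [TopologicalSpace K] [IsTopologicalRing K] [T2Space K] in
theorem coeff_crankSeries (z : K) (n : ℕ) :
    coeff n (crankSeries z) = ∑ L ∈ Finset.range (n + 1), coeff n (crankTerm z L) := by
  have h (L : ℕ) : coeff n (crankTerm z L) = ∑ p : n.Partition,
      if p.parts.count 1 = 0 then (if p.parts.sup = L then z ^ partitionCrank p else 0) else
        (if p.parts.count 1 = L then z ^ partitionCrank p else 0) := by
    have hite : coeff n (if L = 0 then 0 else onesSeries z L) = ∑ p : n.Partition,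
        if L = 0 then 0 else if p.parts.count 1 = L then
          z ^ ((p.parts.filter (L < ·)).card - L : ℤ) else 0 := by
      split_ifs <;> simp [onesSeries]
    rw [crankTerm, map_add, hite, coeff_C_mul, noOnesSeries, coeff_mk, Finset.mul_sum,
      ← Finset.sum_add_distrib]
    refine Finset.sum_congr rfl fun p _ ↦ ?_
    rw [partitionCrank]
    by_cases h0 : p.parts.count 1 = 0
    · by_cases h1 : p.parts.sup = L <;> simp +contextual [h0, h1, eq_comm]
    · by_cases h1 : p.parts.count 1 = L
      · subst h1
        simp [h0]
      · simp [h0, h1]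
  simp_rw [h, crankSeries, coeff_mk]
  rw [Finset.sum_comm]
  refine Finset.sum_congr rfl fun p _ ↦ ?_
  have h1 : p.parts.sup < n + 1 :=
    Nat.lt_succ_of_le (Multiset.sup_le.2 fun i hi ↦ p.le_of_mem_parts hi)
  have h2 : p.parts.count 1 < n + 1 := by
    have := Multiset.card_nsmul_le_sum (s := p.parts) (a := 1) fun i hi ↦ p.parts_pos hi
    rw [p.parts_sum, nsmul_one] at this
    exact Nat.lt_succ_of_le ((Multiset.count_le_card _ _).trans this)
  by_cases h0 : p.parts.count 1 = 0 <;> simp [h0, h1, h2]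

theorem crankTerm_eq {z : K} (hz : z ≠ 0) (L : ℕ) :
    crankTerm z L = (1 - X) * qBinomTerm 0 z 1 L +
      (1 - X) * (qPochInf z)⁻¹ * qBinomTerm z z⁻¹ 1 L +
      ((if L = 0 then X - (1 - X) * (qPochInf z)⁻¹ else 0) + if L = 1 then -C z * X else 0) := by
  have h0 : ∀ n, qPoch (0 : K) n = 1 := by simp [qPoch]
  rcases L with _ | _ | L
  · simp [crankTerm, qBinomTerm, noOnesSeries_zero]
  · have h1 := qPoch_mul_inv (1 : K) 1
    have h2 : qPoch (1 : K) 1 = 1 - X := by simp [qPoch]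
    rw [crankTerm, zero_add, if_neg one_ne_zero, if_neg one_ne_zero, if_pos rfl,
      noOnesSeries_one, onesSeries_eq hz le_rfl, qBinomTerm, qBinomTerm, h0]
    simp only [pow_one, mul_one]
    linear_combination -C z * X * h1 + C z * X * (qPoch 1 1)⁻¹ * h2
  · rw [crankTerm, if_neg (by omega), if_neg (by omega), if_neg (by omega),
      noOnesSeries_succ (by omega), onesSeries_eq hz (by omega), qBinomTerm, qBinomTerm, h0]
    simp only [one_mul]
    ring

/-- The product formula for the generating function of the crank. -/
theorem crankSeries_add_mul {z : K} (hz : z ≠ 0) :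
    (crankSeries z + (C z - 1) * X) * (qPochInf z * qPochInf z⁻¹) = qPochInf 1 := by
  have hd : ∀ y r j, X ^ j ∣ (qBinomTerm y r 1 j : K⟦X⟧) := fun y r ↦ X_pow_dvd_qBinomTerm y r 0
  have hs := ((((summable_of_X_pow_dvd (hd 0 z)).hasSum.mul_left (1 - X)).add
    ((summable_of_X_pow_dvd (hd z z⁻¹)).hasSum.mul_left ((1 - X) * (qPochInf z)⁻¹))).add
    ((hasSum_ite_eq 0 (X - (1 - X) * (qPochInf z)⁻¹)).add (hasSum_ite_eq 1 (-C z * X)))).of_eq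
    (crankTerm_eq hz) rfl
  have hX : ∀ j, X ^ j ∣ crankTerm z j := by
    intro j
    rw [crankTerm_eq hz]
    refine dvd_add (dvd_add ((hd _ _ _).mul_left _) ((hd _ _ _).mul_left _)) (dvd_add ?_ ?_)
    · split_ifs with h <;> simp [h]
    · split_ifs with h <;> simp [h]
  have h : crankSeries z = ∑' L, crankTerm z L := by
    ext n
    rw [coeff_crankSeries, coeff_tsum_of_X_pow_dvd hX]
  rw [hs.tsum_eq] at h
  have h1 := tsum_qBinomTerm_mul_qPochInf 0 z
  have h2 := tsum_qBinomTerm_mul_qPochInf z z⁻¹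
  rw [mul_inv_cancel₀ hz] at h2
  simp only [zero_mul, map_zero, sub_zero, mul_one, map_one, one_mul, qPochInf_zero] at h1 h2
  have h3 := qPochInf_mul_inv z
  rw [h]
  linear_combination (1 - X) * qPochInf z⁻¹ * h1 + h2 + ((1 - X) * qPochInf z⁻¹ *
    ((∑' j, qBinomTerm z z⁻¹ 1 j) - 1)) * h3

end CrankSeries

section RootsOfUnity

variable {K : Type*} [Field K]

theorem prod_one_sub_C_pow_mul {ζ : K} {d : ℕ} (hd : 0 < d) (hζ : IsPrimitiveRoot ζ d)
    (f : K⟦X⟧) : ∏ k ∈ Finset.range d, (1 - C (ζ ^ k) * f) = 1 - f ^ d := by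
  have hC : IsPrimitiveRoot (C ζ : K⟦X⟧) d := hζ.map_of_injective C_injective
  have h := hC.pow_sub_pow_eq_prod_sub_mul 1 f hd
  rw [one_pow] at h
  classical
  rw [h, Polynomial.nthRootsFinset, Finset.prod, Finset.prod, Multiset.toFinset_val,
    Multiset.dedup_eq_self.2 hC.nthRoots_one_nodup, hC.nthRoots_eq (one_pow d), Multiset.map_map]
  simp

theorem coeff_mul_eq_zero_of_dvd {d : ℕ} {f g : K⟦X⟧} (hf : ∀ n, ¬ d ∣ n → coeff n f = 0)
    (hg : ∀ n, ¬ d ∣ n → coeff n g = 0) (n : ℕ) (hn : ¬ d ∣ n) : coeff n (f * g) = 0 := by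
  rw [coeff_mul]
  refine Finset.sum_eq_zero fun p hp ↦ ?_
  rw [Finset.HasAntidiagonal.mem_antidiagonal] at hp
  by_cases h : d ∣ p.1
  · rw [hg p.2 fun h' ↦ hn (hp ▸ dvd_add h h'), mul_zero]
  · rw [hf p.1 h, zero_mul]

theorem coeff_prod_qPochInf_eq_zero [TopologicalSpace K] [IsTopologicalRing K] [T2Space K]
    {ζ : K} {d : ℕ} (hd : 0 < d) (hζ : IsPrimitiveRoot ζ d) {m : ℕ} (hm : ¬ d ∣ m) :
    coeff m (∏ k ∈ Finset.range d, qPochInf (ζ ^ k)) = 0 := by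
  have lim := tendsto_finsetProd (Finset.range d) fun k _ ↦ tendsto_qPoch (ζ ^ k)
  rw [WithPiTopology.tendsto_iff_coeff_tendsto] at lim
  refine tendsto_nhds_unique (lim m) (tendsto_const_nhds.congr fun n ↦ ?_)
  simp_rw [qPoch]
  rw [Finset.prod_comm]
  simp_rw [prod_one_sub_C_pow_mul hd hζ]
  symm
  induction n generalizing m with
  | zero =>
    rw [Finset.prod_range_zero, coeff_one, if_neg]
    rintro rfl
    exact hm (dvd_zero d)
  | succ n ih =>
    rw [Finset.prod_range_succ]
    refine coeff_mul_eq_zero_of_dvd (fun i hi ↦ ih hi) (fun i hi ↦ ?_) m hm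
    rw [map_sub, coeff_one, ← pow_mul, coeff_X_pow, if_neg, if_neg, sub_zero]
    · rintro rfl
      exact hi (dvd_mul_left d _)
    · rintro rfl
      exact hi (dvd_zero d)

theorem coeff_eq_zero_of_coeff_mul_eq_zero {d r : ℕ} {f g : K⟦X⟧} (hg0 : constantCoeff g = 1)
    (hg : ∀ m, ¬ d ∣ m → coeff m g = 0) (h : ∀ n, coeff (d * n + r) (f * g) = 0) (hr : r < d)
    (n : ℕ) : coeff (d * n + r) f = 0 := by
  induction n using Nat.strong_induction_on with
  | _ n ih =>
    have key := h n
    rw [coeff_mul, Finset.sum_eq_single (d * n + r, 0)] at key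
    · simpa [hg0] using key
    · rintro ⟨i, j⟩ hij hne
      rw [Finset.HasAntidiagonal.mem_antidiagonal] at hij
      dsimp only at hij ⊢
      by_cases hj : d ∣ j
      · obtain ⟨k, rfl⟩ := hj
        have hk : k ≤ n := by
          by_contra! hk
          have := Nat.mul_le_mul_left d (Nat.succ_le_of_lt hk)
          rw [Nat.mul_succ] at this
          omega
        obtain ⟨l, rfl⟩ := Nat.exists_eq_add_of_le hk
        have hi : i = d * l + r := by rw [mul_add] at hij; omega
        have hk0 : k ≠ 0 := by
          rintro rfl
          exact hne (by simp [hi])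
        rw [hi, ih l (by omega), zero_mul]
      · rw [hg j hj, mul_zero]
    · intro hmem
      exact absurd (Finset.HasAntidiagonal.mem_antidiagonal.2 (add_zero _)) hmem

end RootsOfUnity

section ModEleven

variable {K : Type*} [Field K] [TopologicalSpace K] [IsTopologicalRing K] [T2Space K]

theorem eleven_dvd_of_three_mul_triangular_add_pentagonal {x y : ℤ} {n : ℕ}
    (h : 3 * triangular x + pentagonal y = 11 * n + 6) : (11 : ℤ) ∣ 6 * y - 1 := by
  have hx := two_mul_triangular x
  have hy := two_mul_natCast_pentagonal y
  have key : (x * (3 * x - 3) + y * (3 * y - 1) : ℤ) = 11 * (2 * n) + 12 := by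
    zify at h
    linear_combination 2 * h - 3 * hx - hy
  have hz : ((x : ZMod 11) * (3 * x - 3) + y * (3 * y - 1)) = 1 := by
    have := congrArg (Int.cast : ℤ → ZMod 11) key
    push_cast at this
    rw [this, show (11 : ZMod 11) = 0 from rfl, zero_mul, zero_add]
    rfl
  refine (ZMod.intCast_zmod_eq_zero_iff_dvd _ 11).1 ?_
  push_cast
  generalize (x : ZMod 11) = u at hz
  generalize (y : ZMod 11) = v at hz ⊢
  revert u v
  decide

omit [T2Space K] in
theorem hasSum_pentagonalTheta_sub (b : K) :
    HasSum (fun y : ℤ ↦ C ((-1) ^ y * (b ^ (3 * y) - b * b⁻¹ ^ (3 * y))) * X ^ pentagonal y)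
      (pentagonalTheta b - C b * pentagonalTheta b⁻¹) := by
  have h (c : K) : HasSum (fun y : ℤ ↦ C ((-1) ^ y * c ^ (3 * y)) * X ^ pentagonal y)
      (pentagonalTheta c) := (summable_C_mul_X_pow _ finite_pentagonal_le).hasSum
  refine ((h b).sub ((h b⁻¹).mul_left (C b))).of_eq (fun y ↦ ?_) rfl
  simp only [map_mul, map_sub]
  ring

theorem coeff_cubicTheta_mul_eq_zero (a : K) {b : K} (hb : b ^ 11 = 1) (n : ℕ) :
    coeff (11 * n + 6) (cubicTheta a * (pentagonalTheta b - C b * pentagonalTheta b⁻¹)) = 0 := by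
  have hb0 : b ≠ 0 := by rintro rfl; simp at hb
  have ha : HasSum (fun x : ℤ ↦ C ((-1) ^ x * a ^ (3 * x)) * X ^ (3 * triangular x))
    (cubicTheta a) := (summable_C_mul_X_pow _ finite_three_mul_triangular_le).hasSum
  have h := hasSum_C_mul_X_pow_mul finite_three_mul_triangular_le finite_pentagonal_le ha
    (hasSum_pentagonalTheta_sub b)
  rw [WithPiTopology.hasSum_iff_hasSum_coeff] at h
  refine (h (11 * n + 6)).unique (hasSum_zero.of_eq (fun v ↦ ?_) rfl)
  rw [coeff_C_mul, coeff_X_pow]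
  split_ifs with hv
  · obtain ⟨k, hk⟩ := eleven_dvd_of_three_mul_triangular_add_pentagonal hv.symm
    have h1 : b ^ (6 * v.2 - 1) = 1 := by
      rw [hk, zpow_mul, show (11 : ℤ) = (11 : ℕ) from rfl, zpow_natCast, hb, one_zpow]
    have h2 : b ^ (3 * v.2) = b * b⁻¹ ^ (3 * v.2) := by
      rw [inv_zpow', ← zpow_one_add₀ hb0, ← mul_one (b ^ (1 + _)), ← h1, ← zpow_add₀ hb0]
      congr 1
      ring
    rw [h2, sub_self, mul_zero, mul_zero, zero_mul]
  · rw [mul_zero]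

theorem coeff_thetaProd_mul_div_eq_zero [CharZero K] {a b : K} (ha : a ^ 11 = 1) (hb : b ^ 11 = 1)
    {f : K⟦X⟧} (hf : thetaProd a * (thetaProd b * (thetaProd (a * b) * thetaProd (a / b))) =
      qPochInf 1 ^ 2 * f) (n : ℕ) : coeff (11 * n + 6) f = 0 := by
  have ha0 : a ≠ 0 := by rintro rfl; simp at ha
  have hb0 : b ≠ 0 := by rintro rfl; simp at hb
  rw [winquist_identity ha0 hb0] at hf
  rw [← mul_left_cancel₀ (pow_ne_zero 2 (qPochInf_ne_zero 1)) hf, map_sub, coeff_C_mul,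
    coeff_cubicTheta_mul_eq_zero a hb, coeff_cubicTheta_mul_eq_zero b ha, mul_zero, sub_zero]

theorem coeff_crankSeries_eq_zero [CharZero K] {ζ : K} (hζ : IsPrimitiveRoot ζ 11) (n : ℕ) :
    coeff (11 * n + 6) (crankSeries ζ) = 0 := by
  have h11 := hζ.pow_eq_one
  have h0 : ζ ≠ 0 := hζ.ne_zero (by norm_num)
  have inv {i j : ℕ} (h : i + j = 11) : (ζ ^ i)⁻¹ = ζ ^ j :=
    inv_eq_of_mul_eq_one_right (by rw [← pow_add, h, h11])
  have ne {i : ℕ} (hi : 0 < i) (hi' : i < 11) : 1 - ζ ^ i ≠ 0 :=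
    sub_ne_zero.2 (hζ.pow_ne_one_of_pos_of_lt hi.ne' hi').symm
  set κ : K := (1 - ζ ^ 5) * (1 - ζ ^ 2) * (1 - ζ ^ 7) * (1 - ζ ^ 3) with hκ
  have hκ0 : κ ≠ 0 := by
    simp only [hκ]
    exact mul_ne_zero (mul_ne_zero (mul_ne_zero (ne (by norm_num) (by norm_num))
      (ne (by norm_num) (by norm_num))) (ne (by norm_num) (by norm_num)))
      (ne (by norm_num) (by norm_num))
  set F : K⟦X⟧ := crankSeries ζ + (C ζ - 1) * X with hF
  set G : K⟦X⟧ := ∏ k ∈ Finset.range 11, qPochInf (ζ ^ k) with hG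
  have hprod : thetaProd (ζ ^ 5) * (thetaProd (ζ ^ 2) * (thetaProd (ζ ^ 5 * ζ ^ 2) *
      thetaProd (ζ ^ 5 / ζ ^ 2))) = qPochInf 1 ^ 2 * (C κ * (F * G)) := by
    have hcrank := crankSeries_add_mul h0
    rw [inv_eq_of_mul_eq_one_right (show ζ * ζ ^ 10 = 1 by rw [← pow_succ', h11]), ← hF] at hcrank
    have hdiv : ζ ^ 5 / ζ ^ 2 = ζ ^ 3 := by field_simp
    rw [hdiv, show ζ ^ 5 * ζ ^ 2 = ζ ^ 7 by ring]
    simp only [thetaProd, inv (show 5 + 6 = 11 by norm_num), inv (show 2 + 9 = 11 by norm_num),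
      inv (show 7 + 4 = 11 by norm_num), inv (show 3 + 8 = 11 by norm_num), hG, hκ,
      Finset.prod_range_succ, Finset.prod_range_zero, map_mul, map_sub, map_one, pow_zero, pow_one,
      one_mul]
    linear_combination (-qPochInf 1 ^ 3 * ((1 - C (ζ ^ 5)) * (1 - C (ζ ^ 2)) * (1 - C (ζ ^ 7)) *
      (1 - C (ζ ^ 3))) * (qPochInf (ζ ^ 2) * qPochInf (ζ ^ 3) * qPochInf (ζ ^ 4) *
      qPochInf (ζ ^ 5) * qPochInf (ζ ^ 6) * qPochInf (ζ ^ 7) * qPochInf (ζ ^ 8) *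
      qPochInf (ζ ^ 9))) * hcrank
  have hFG := coeff_thetaProd_mul_div_eq_zero (by rw [← pow_mul, mul_comm, pow_mul, h11, one_pow])
    (by rw [← pow_mul, mul_comm, pow_mul, h11, one_pow]) hprod
  have hFn : coeff (11 * n + 6) F = 0 := by
    refine coeff_eq_zero_of_coeff_mul_eq_zero (g := G) ?_
      (fun m hm ↦ coeff_prod_qPochInf_eq_zero (by norm_num) hζ hm) (fun m ↦ ?_) (by norm_num) n
    · simp [hG, map_prod]
    · have := hFG m
      rw [coeff_C_mul] at this
      exact (mul_eq_zero.1 this).resolve_left hκ0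
  have hX : coeff (11 * n + 6) ((C ζ - 1) * X) = 0 := by
    rw [show (C ζ - 1 : K⟦X⟧) = C (ζ - 1) by simp, coeff_C_mul, coeff_X, if_neg (by omega),
      mul_zero]
  rwa [hF, map_add, hX, add_zero] at hFn

end ModEleven

theorem card_filter_crank_emod {n d : ℕ} (hd : 0 < d) {ζ : ℂ} (hζ : IsPrimitiveRoot ζ d)
    (h : ∀ r ∈ Finset.range d, r ≠ 0 → ∑ p : n.Partition, (ζ ^ r) ^ partitionCrank p = 0)
    {k : ℤ} (hk0 : 0 ≤ k) (hk : k < d) :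
    (d * (Finset.univ.filter fun p : n.Partition ↦ partitionCrank p % d = k).card : ℂ) =
      Fintype.card n.Partition := by
  have h0 : ζ ≠ 0 := hζ.ne_zero hd.ne'
  have hgeom (m : ℤ) : ∑ r ∈ Finset.range d, (ζ ^ m) ^ r = if (d : ℤ) ∣ m then (d : ℂ) else 0 := by
    split_ifs with hm
    · simp [(hζ.zpow_eq_one_iff_dvd m).2 hm]
    · have hne : ζ ^ m - 1 ≠ 0 := sub_ne_zero.2 fun h ↦ hm ((hζ.zpow_eq_one_iff_dvd m).1 h)
      have hpow : (ζ ^ m) ^ d - 1 = 0 := by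
        rw [← zpow_natCast, ← zpow_mul, mul_comm, zpow_mul, zpow_natCast, hζ.pow_eq_one, one_zpow,
          sub_self]
      exact (mul_eq_zero.1 ((geom_sum_mul (ζ ^ m) d).trans hpow)).resolve_right hne
  have hiff (p : n.Partition) : partitionCrank p % d = k ↔ (d : ℤ) ∣ partitionCrank p - k := by
    rw [← Int.emod_eq_emod_iff_emod_sub_eq_zero.trans (Int.dvd_iff_emod_eq_zero).symm,
      Int.emod_eq_of_lt hk0 hk]
  calc (d * (Finset.univ.filter fun p : n.Partition ↦ partitionCrank p % d = k).card : ℂ)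
      = ∑ p : n.Partition, ∑ r ∈ Finset.range d, (ζ ^ (partitionCrank p - k)) ^ r := by
        simp_rw [hgeom, ← hiff]
        rw [← Finset.sum_filter, Finset.sum_const, nsmul_eq_mul, mul_comm]
    _ = ∑ r ∈ Finset.range d, (ζ ^ r) ^ (-k) * ∑ p : n.Partition, (ζ ^ r) ^ partitionCrank p := by
        rw [Finset.sum_comm]
        refine Finset.sum_congr rfl fun r _ ↦ ?_
        rw [Finset.mul_sum]
        refine Finset.sum_congr rfl fun p _ ↦ ?_
        rw [← zpow_add₀ (pow_ne_zero r h0), ← zpow_natCast, ← zpow_natCast, ← zpow_mul, ← zpow_mul]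
        congr 1
        ring
    _ = Fintype.card n.Partition := by
        rw [Finset.sum_eq_single_of_mem 0 (Finset.mem_range.2 hd)
          fun r hr hr0 ↦ by rw [h r hr hr0, mul_zero]]
        simp

end

/-- **Andrews–Garvan mod 11**: for every `n ≥ 0` and every `0 ≤ k ≤ 10`, the number of
partitions of `11n + 6` with crank congruent to `k` modulo `11` equals `p(11n+6) / 11`. -/
theorem crank_equidistribution_mod_eleven (n : ℕ) (k : ℤ) (hk0 : 0 ≤ k) (hk10 : k ≤ 10) :
    ((Finset.univ.filter
        (fun p : Nat.Partition (11 * n + 6) => partitionCrank p % 11 = k)).card : ℚ) =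
      (Fintype.card (Nat.Partition (11 * n + 6)) : ℚ) / 11 := by
  have hζ := Complex.isPrimitiveRoot_exp 11 (by norm_num)
  have h := card_filter_crank_emod (n := 11 * n + 6) (by norm_num) hζ (fun r hr hr0 ↦ ?_) hk0
    (show k < (11 : ℕ) by omega)
  · rw [eq_div_iff (by norm_num), mul_comm]
    exact_mod_cast h
  · have hcop : r.Coprime 11 := ((Nat.Prime.coprime_iff_not_dvd (by norm_num)).2
      (Nat.not_dvd_of_pos_of_lt (by omega) (Finset.mem_range.1 hr))).symm
    simpa [crankSeries] using coeff_crankSeries_eq_zero (hζ.pow_of_coprime r hcop) n
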